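/- Let n ≥ 1 and let Q_1, …, Q_{n²} be n×n complex Hermitian matrices forming an orthonormal family with respect to the real inner product ⟨A,B⟩ = Re tr(A Bᴴ). Then for all nonnegative real numbers x_1, …, x_{n²}, Σ_{α,β=1}^{n²} x_α x_β ‖[Q_α, Q_β]‖² ≤ (4/3)(Σ_{α=1}^{n²} x_α)². -/

import Mathlib

open Matrix

/-- Squared Frobenius norm of a complex matrix: `Re tr (A Aᴴ)`. -/
noncomputable def frobSq {n : ℕ} (A : Matrix (Fin n) (Fin n) ℂ) : ℝ :=
  ((A * Aᴴ).trace).re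

/-- Real inner product on complex matrices: `Re tr (A Bᴴ)`. -/
noncomputable def minner {n : ℕ} (A B : Matrix (Fin n) (Fin n) ℂ) : ℝ :=
  ((A * Bᴴ).trace).re

/-- Commutator of matrices. -/
noncomputable def mcomm {n : ℕ} (A B : Matrix (Fin n) (Fin n) ℂ) : Matrix (Fin n) (Fin n) ℂ :=
  A * B - B * A

open Finset in
/-- If in each row of a symmetric matrix with zero diagonal the total excess of the entries over
`c` is at most `c`, then its quadratic form is at most `c (∑ x)²` on the nonnegative orthant. -/
theorem quadratic_form_le_of_sum_sub_le {ι : Type*} [Fintype ι] (M : ι → ι → ℝ) {c : ℝ}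
    (hc : 0 ≤ c) (hsymm : ∀ α β, M α β = M β α) (hdiag : ∀ α, M α α = 0)
    (hM : ∀ (α : ι) (S : Finset ι), ∑ β ∈ S, (M α β - c) ≤ c)
    (x : ι → ℝ) (hx : ∀ α, 0 ≤ x α) :
    ∑ α, ∑ β, x α * x β * M α β ≤ c * (∑ α, x α) ^ 2 := by
  classical
  rcases (sum_nonneg fun i _ ↦ hx i : 0 ≤ ∑ i, x i).eq_or_lt with hs | hs
  · have h0 : ∀ i, x i = 0 := fun i ↦
      (sum_eq_zero_iff_of_nonneg fun i _ ↦ hx i).1 hs.symm i (mem_univ i)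
    simp [h0]
  set q : (ι → ℝ) → ℝ := fun y ↦ ∑ α, ∑ β, y α * y β * M α β with hq
  have hsmul : ∀ (t : ℝ) y, q (fun i ↦ t * y i) = t ^ 2 * q y := fun t y ↦ by
    simp only [hq, mul_sum]
    exact sum_congr rfl fun _ _ ↦ sum_congr rfl fun _ _ ↦ by ring
  have hcont : Continuous q := by fun_prop
  have hnorm : ∀ y : ι → ℝ, (∀ i, 0 ≤ y i) → 0 < ∑ i, y i →
      (fun i ↦ (∑ i, y i)⁻¹ * y i) ∈ stdSimplex ℝ ι := fun y hy hpos ↦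
    ⟨fun i ↦ mul_nonneg (inv_nonneg.2 hpos.le) (hy i), by
      rw [← mul_sum, inv_mul_cancel₀ hpos.ne']⟩
  obtain ⟨y, ⟨hy0, hy1⟩, hmax⟩ :=
    (isCompact_stdSimplex (𝕜 := ℝ) ι).exists_isMaxOn ⟨_, hnorm x hx hs⟩ hcont.continuousOn
  have hbound : ∀ z : ι → ℝ, (∀ i, 0 ≤ z i) → 0 < ∑ i, z i → q z ≤ q y * (∑ i, z i) ^ 2 := by
    intro z hz hpos
    have h : q _ ≤ q y := hmax (hnorm z hz hpos)
    rw [hsmul, inv_pow, inv_mul_le_iff₀ (by positivity)] at h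
    linarith
  refine (hbound x hx hs).trans (mul_le_mul_of_nonneg_right ?_ (sq_nonneg _))
  have hne : (univ : Finset ι).Nonempty := by
    by_contra h
    simp [not_nonempty_iff_eq_empty.1 h] at hy1
  obtain ⟨α, -, hα⟩ := exists_max_image univ y hne
  have hypos : 0 < y α := by
    by_contra! h
    have : ∑ i, y i ≤ 0 := sum_nonpos fun i hi ↦ (hα i hi).trans h
    linarith
  -- first order condition at the maximum, in the direction of the coordinate `α`
  have hcrit : q y ≤ ∑ β, M α β * y β := by
    set g := ∑ β, M α β * y β with hg
    have hstep : ∀ t, 0 < t → t ≤ y α → t < 1 → 2 * (q y - g) ≤ q y * t := by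
      intro t ht hty ht1
      have hz : ∀ i, 0 ≤ y i - t * Pi.single (M := fun _ ↦ ℝ) α 1 i := fun i ↦ by
        rcases eq_or_ne i α with rfl | h
        · simpa using hty
        · simpa [h] using hy0 i
      have hzs : ∑ i, (y i - t * Pi.single (M := fun _ ↦ ℝ) α 1 i) = 1 - t := by
        simp [sum_sub_distrib, ← mul_sum, hy1]
      have h := hbound _ hz (by rw [hzs]; linarith)
      rw [hzs] at h
      have hexp : q (fun i ↦ y i - t * Pi.single (M := fun _ ↦ ℝ) α 1 i) = q y - 2 * t * g := by
        have e : ∀ i j, (y i - t * Pi.single (M := fun _ ↦ ℝ) α 1 i) *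
            (y j - t * Pi.single (M := fun _ ↦ ℝ) α 1 j) * M i j =
            y i * y j * M i j - Pi.single (M := fun _ ↦ ℝ) α 1 i * (t * (y j * M i j))
            - Pi.single (M := fun _ ↦ ℝ) α 1 j * (t * (y i * M i j))
            + Pi.single (M := fun _ ↦ ℝ) α 1 i *
              (Pi.single (M := fun _ ↦ ℝ) α 1 j * (t ^ 2 * M i j)) := fun i j ↦ by ring
        simp only [hq, e, sum_add_distrib, sum_sub_distrib, ← mul_sum]
        simp only [Pi.single_apply, ite_mul, one_mul, zero_mul, sum_ite_eq', mem_univ, if_true,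
          hdiag, mul_zero, add_zero, ← mul_sum]
        have e1 : ∑ i, y i * M α i = g := sum_congr rfl fun i _ ↦ mul_comm _ _
        have e2 : ∑ i, y i * M i α = g := by simp only [hsymm _ α, e1]
        rw [e1, e2]
        ring
      rw [hexp] at h
      have : t * (2 * (q y - g)) ≤ t * (q y * t) := by nlinarith
      exact le_of_mul_le_mul_left this ht
    by_contra! hlt
    have hd : 0 < q y - g := by linarith
    set t := min (y α) (min (1 / 2) ((q y - g) / (|q y| + 1))) with ht
    have hp : 0 < |q y| + 1 := by positivity
    have ht0 : 0 < t := by positivity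
    have h1 : t ≤ 1 / 2 := (min_le_right _ _).trans (min_le_left _ _)
    have h2 : t ≤ (q y - g) / (|q y| + 1) := (min_le_right _ _).trans (min_le_right _ _)
    rw [le_div_iff₀ hp] at h2
    have h3 := hstep t ht0 (min_le_left _ _) (by linarith)
    nlinarith [le_abs_self (q y)]
  refine hcrit.trans ?_
  set S := univ.filter fun β ↦ 0 < M α β - c with hS
  have hαS : α ∉ S := by simp [hS, hdiag, hc]
  calc ∑ β, M α β * y β = ∑ β, (M α β - c) * y β + c := by
        simp [sub_mul, sum_sub_distrib, ← mul_sum, hy1]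
    _ ≤ ∑ β, ((if β ∈ S then (M α β - c) * y α else 0) - if β = α then c * y α else 0) + c := by
        gcongr with β
        rcases eq_or_ne β α with rfl | hβ
        · simp [hαS, hdiag]
        by_cases h : 0 < M α β - c
        · rw [if_pos (by simpa [hS] using h), if_neg hβ, sub_zero]
          exact mul_le_mul_of_nonneg_left (hα β (mem_univ _)) h.le
        · rw [if_neg (by simpa [hS] using h), if_neg hβ, sub_zero]
          exact mul_nonpos_of_nonpos_of_nonneg (not_lt.1 h) (hy0 β)
    _ = (∑ β ∈ S, (M α β - c)) * y α - c * y α + c := by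
        simp only [sum_sub_distrib (s := univ), sum_ite_mem, univ_inter, sum_ite_eq', mem_univ,
          if_true, sum_mul]
    _ ≤ c := by nlinarith [hM α S]

open Finset in
/-- The star bound: `∑ (a - b_j)²` over `p` indices is at most `(p + 1) (a² + ∑ b_j²)`. -/
theorem sum_sq_sub_le_card_add_one_mul {ι : Type*} (S : Finset ι) (a : ℝ) (b : ι → ℝ) :
    ∑ j ∈ S, (a - b j) ^ 2 ≤ (#S + 1) * (a ^ 2 + ∑ j ∈ S, b j ^ 2) := by
  rcases S.eq_empty_or_nonempty with rfl | hS
  · simpa using sq_nonneg a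
  have hp : (0 : ℝ) < #S := by exact_mod_cast hS.card_pos
  calc ∑ j ∈ S, (a - b j) ^ 2
      ≤ ∑ j ∈ S, ((1 + (#S : ℝ)⁻¹) * a ^ 2 + (#S + 1) * b j ^ 2) := by
        gcongr with j
        have h : 0 ≤ (#S : ℝ)⁻¹ * (a + #S * b j) ^ 2 := by positivity
        have e : (#S : ℝ)⁻¹ * (a + #S * b j) ^ 2
            = (#S : ℝ)⁻¹ * a ^ 2 + 2 * a * b j + #S * b j ^ 2 := by field_simp; ring
        nlinarith
    _ = _ := by
        rw [sum_add_distrib, sum_const, nsmul_eq_mul, ← mul_sum]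
        field_simp

open Finset in
/-- For a unit vector, the total excess of the squared differences over `4 / 3` is at most `4 / 3`:
every pair with positive excess contains an entry of largest modulus. -/
theorem sum_max_sq_sub_le {ι : Type*} [Fintype ι] (a : ι → ℝ) (ha : ∑ i, a i ^ 2 = 1) :
    ∑ i, ∑ j, max ((a i - a j) ^ 2 - 4 / 3) 0 ≤ 4 / 3 := by
  classical
  have hne : (univ : Finset ι).Nonempty := by
    by_contra h
    simp [not_nonempty_iff_eq_empty.1 h] at ha
  obtain ⟨m, -, hm⟩ := exists_max_image univ (fun i ↦ a i ^ 2) hne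
  have hle : ∀ T : Finset ι, ∑ i ∈ T, a i ^ 2 ≤ 1 := fun T ↦
    ha ▸ sum_le_sum_of_subset_of_nonneg (subset_univ T) fun i _ _ ↦ sq_nonneg _
  have hz : ∀ i j, i ≠ m → j ≠ m → max ((a i - a j) ^ 2 - 4 / 3) 0 = 0 := by
    intro i j hi hj
    rw [max_eq_right_iff]
    rcases eq_or_ne i j with rfl | hij
    · norm_num
    have h := hle {m, i, j}
    rw [sum_insert (by simp [hi.symm, hj.symm]), sum_pair hij] at h
    have h1 := hm i (mem_univ _)
    have h2 := hm j (mem_univ _)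
    nlinarith [sq_nonneg (a i + a j)]
  set S := univ.filter fun j ↦ 0 < (a m - a j) ^ 2 - 4 / 3 with hS
  have hmS : m ∉ S := by norm_num [hS]
  have hstar : ∑ j, max ((a m - a j) ^ 2 - 4 / 3) 0 ≤ 2 / 3 := by
    have e : ∑ j, max ((a m - a j) ^ 2 - 4 / 3) 0 = ∑ j ∈ S, ((a m - a j) ^ 2 - 4 / 3) := by
      rw [hS, sum_filter]
      refine sum_congr rfl fun j _ ↦ ?_
      split_ifs with h
      · exact max_eq_left h.le
      · exact max_eq_right (not_lt.1 h)
    rw [e]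
    rcases S.eq_empty_or_nonempty with h0 | h0
    · rw [h0]; norm_num
    have hp : (1 : ℝ) ≤ #S := by exact_mod_cast h0.card_pos
    have h := hle (insert m S)
    rw [sum_insert hmS] at h
    have h' := sum_sq_sub_le_card_add_one_mul S (a m) a
    rw [sum_sub_distrib, sum_const, nsmul_eq_mul]
    nlinarith
  have hsplit : ∀ i j, max ((a i - a j) ^ 2 - 4 / 3) 0 ≤
      (if i = m then max ((a m - a j) ^ 2 - 4 / 3) 0 else 0) +
      if j = m then max ((a m - a i) ^ 2 - 4 / 3) 0 else 0 := by
    intro i j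
    by_cases hi : i = m <;> by_cases hj : j = m
    · subst hi; subst hj; norm_num
    · simp [hi, hj]
    · simp [hi, hj, sub_sq_comm (a i)]
    · simp [hi, hj, hz i j hi hj]
  calc _ ≤ _ := sum_le_sum fun i _ ↦ sum_le_sum fun j _ ↦ hsplit i j
    _ = ∑ j, max ((a m - a j) ^ 2 - 4 / 3) 0 + ∑ j, max ((a m - a j) ^ 2 - 4 / 3) 0 := by
        simp only [sum_add_distrib, sum_ite_eq', mem_univ, if_true]
        rw [sum_comm]
        simp
    _ ≤ 4 / 3 := by linarith

theorem frobSq_eq_sum {n : ℕ} (A : Matrix (Fin n) (Fin n) ℂ) :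
    frobSq A = ∑ i, ∑ j, ‖A i j‖ ^ 2 := by
  simp [frobSq, Matrix.trace, Matrix.mul_apply, Complex.mul_conj, ← Complex.normSq_eq_norm_sq]

theorem minner_self {n : ℕ} (A : Matrix (Fin n) (Fin n) ℂ) : minner A A = frobSq A := rfl

theorem mcomm_swap {n : ℕ} (A B : Matrix (Fin n) (Fin n) ℂ) : mcomm A B = -mcomm B A := by
  simp [mcomm]

theorem frobSq_neg {n : ℕ} (A : Matrix (Fin n) (Fin n) ℂ) : frobSq (-A) = frobSq A := by
  simp [frobSq]

theorem minner_conj {n : ℕ} {U : Matrix (Fin n) (Fin n) ℂ} (hU : U * Uᴴ = 1)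
    (A B : Matrix (Fin n) (Fin n) ℂ) : minner (Uᴴ * A * U) (Uᴴ * B * U) = minner A B := by
  have e : Uᴴ * A * U * (Uᴴ * B * U)ᴴ = Uᴴ * (A * Bᴴ * U) := by
    simp only [conjTranspose_mul, conjTranspose_conjTranspose]
    calc _ = Uᴴ * A * (U * Uᴴ) * Bᴴ * U := by simp only [Matrix.mul_assoc]
      _ = _ := by simp only [hU, Matrix.mul_assoc, Matrix.one_mul]
  rw [minner, minner, e, trace_mul_comm, Matrix.mul_assoc, hU, Matrix.mul_one]

theorem mcomm_conj {n : ℕ} {U : Matrix (Fin n) (Fin n) ℂ} (hU : U * Uᴴ = 1)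
    (A B : Matrix (Fin n) (Fin n) ℂ) :
    mcomm (Uᴴ * A * U) (Uᴴ * B * U) = Uᴴ * mcomm A B * U := by
  have e : ∀ A B : Matrix (Fin n) (Fin n) ℂ,
      Uᴴ * A * U * (Uᴴ * B * U) = Uᴴ * (A * B) * U := fun A B ↦ by
    calc _ = Uᴴ * A * (U * Uᴴ) * B * U := by simp only [Matrix.mul_assoc]
      _ = _ := by simp only [hU, Matrix.mul_assoc, Matrix.one_mul]
  simp only [mcomm, e, Matrix.mul_sub, Matrix.sub_mul]

theorem frobSq_mcomm_diagonal {n : ℕ} (a : Fin n → ℝ) (B : Matrix (Fin n) (Fin n) ℂ) :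
    frobSq (mcomm (diagonal fun i ↦ (a i : ℂ)) B) =
      ∑ i, ∑ j, (a i - a j) ^ 2 * ‖B i j‖ ^ 2 := by
  rw [frobSq_eq_sum]
  refine Finset.sum_congr rfl fun i _ ↦ Finset.sum_congr rfl fun j _ ↦ ?_
  have e : mcomm (diagonal fun i ↦ (a i : ℂ)) B i j = ((a i - a j : ℝ) : ℂ) * B i j := by
    simp only [mcomm, Matrix.sub_apply, diagonal_mul, mul_diagonal]
    push_cast
    ring
  rw [e, norm_mul, mul_pow, Complex.norm_real, Real.norm_eq_abs, sq_abs]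

/-- Bessel's inequality, entrywise, for a family of Hermitian matrices. -/
theorem sum_norm_sq_apply_le_one {n : ℕ} {ι : Type*} [DecidableEq ι]
    (Q : ι → Matrix (Fin n) (Fin n) ℂ) (hHerm : ∀ α, (Q α)ᴴ = Q α)
    (hON : ∀ α β, minner (Q α) (Q β) = if α = β then 1 else 0) (S : Finset ι) (i j : Fin n) :
    ∑ β ∈ S, ‖Q β i j‖ ^ 2 ≤ 1 := by
  set v : ι → EuclideanSpace ℂ (Fin n × Fin n) := fun β ↦ WithLp.toLp 2 fun p ↦ Q β p.1 p.2
    with hv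
  have hinner : ∀ α β, inner ℂ (v α) (v β) = (Q β * (Q α)ᴴ).trace := fun α β ↦ by
    simp [hv, PiLp.inner_apply, Matrix.trace, Matrix.mul_apply, Fintype.sum_prod_type]
  have hvON : Orthonormal ℂ v := by
    rw [orthonormal_iff_ite]
    intro α β
    rw [hinner]
    apply Complex.ext
    · rw [← minner, hON]
      simp only [eq_comm (a := α)]
      split_ifs <;> simp
    · have h : star (Q β * (Q α)ᴴ).trace = (Q β * (Q α)ᴴ).trace := by
        rw [← trace_conjTranspose, conjTranspose_mul, conjTranspose_conjTranspose, hHerm, hHerm,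
          trace_mul_comm]
      rw [Complex.conj_eq_iff_im.1 h]
      split_ifs <;> simp
  have h := hvON.sum_inner_products_le (EuclideanSpace.single (i, j) 1) (s := S)
  simpa [hv, EuclideanSpace.inner_single_right] using h

theorem sum_frobSq_mcomm_sub_le {n : ℕ} {ι : Type*} [DecidableEq ι]
    (Q : ι → Matrix (Fin n) (Fin n) ℂ) (hHerm : ∀ α, (Q α)ᴴ = Q α)
    (hON : ∀ α β, minner (Q α) (Q β) = if α = β then 1 else 0) (α : ι) (S : Finset ι) :
    ∑ β ∈ S, (frobSq (mcomm (Q α) (Q β)) - 4 / 3) ≤ 4 / 3 := by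
  have hA : (Q α).IsHermitian := hHerm α
  set a := hA.eigenvalues
  obtain ⟨U, hU, hD⟩ : ∃ U : Matrix (Fin n) (Fin n) ℂ, U * Uᴴ = 1 ∧
      Uᴴ * Q α * U = diagonal fun i ↦ (a i : ℂ) :=
    ⟨hA.eigenvectorUnitary, Unitary.coe_mul_star_self _, by
      simpa [Unitary.conjStarAlgAut_star_apply, star_eq_conjTranspose, Function.comp_def] using
        hA.conjStarAlgAut_star_eigenvectorUnitary⟩
  set R := fun β ↦ Uᴴ * Q β * U with hR
  have hRHerm : ∀ β, (R β)ᴴ = R β := fun β ↦ by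
    simp [hR, conjTranspose_mul, hHerm, Matrix.mul_assoc]
  have hRON : ∀ β γ, minner (R β) (R γ) = if β = γ then 1 else 0 := fun β γ ↦ by
    rw [← hON]
    exact minner_conj hU _ _
  have hnorm : ∀ β, ∑ i, ∑ j, ‖R β i j‖ ^ 2 = 1 := fun β ↦ by
    rw [← frobSq_eq_sum, ← minner_self, hRON, if_pos rfl]
  have ha : ∑ i, a i ^ 2 = 1 := by
    rw [← hnorm α]
    refine Finset.sum_congr rfl fun i _ ↦ ?_
    simp only [hR, hD, diagonal_apply]
    rw [Finset.sum_eq_single i (fun j _ hj ↦ by simp [hj.symm]) (by simp)]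
    simp
  have hcomm : ∀ β, frobSq (mcomm (Q α) (Q β)) - 4 / 3 =
      ∑ i, ∑ j, ((a i - a j) ^ 2 - 4 / 3) * ‖R β i j‖ ^ 2 := fun β ↦ by
    rw [← minner_self, ← minner_conj hU, ← mcomm_conj hU, hD, minner_self,
      frobSq_mcomm_diagonal]
    simp only [sub_mul, Finset.sum_sub_distrib, ← Finset.mul_sum]
    rw [hnorm, mul_one]
  simp only [hcomm]
  rw [Finset.sum_comm]
  simp only [Finset.sum_comm (s := S), ← Finset.mul_sum]
  refine le_trans ?_ (sum_max_sq_sub_le a ha)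
  gcongr with i _ j _
  have h0 : 0 ≤ ∑ β ∈ S, ‖R β i j‖ ^ 2 := by positivity
  have h1 := sum_norm_sq_apply_le_one R hRHerm hRON S i j
  calc _ ≤ max ((a i - a j) ^ 2 - 4 / 3) 0 * ∑ β ∈ S, ‖R β i j‖ ^ 2 :=
        mul_le_mul_of_nonneg_right (le_max_left _ _) h0
    _ ≤ _ := mul_le_of_le_one_right (le_max_right _ _) h1

theorem ddvv_quadratic_form (n : ℕ) (hn : 1 ≤ n)
    (Q : Fin (n ^ 2) → Matrix (Fin n) (Fin n) ℂ)
    (hHerm : ∀ α, (Q α)ᴴ = Q α)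
    (hON : ∀ α β, minner (Q α) (Q β) = if α = β then 1 else 0)
    (x : Fin (n ^ 2) → ℝ) (hx : ∀ α, 0 ≤ x α) :
    ∑ α : Fin (n ^ 2), ∑ β : Fin (n ^ 2), x α * x β * frobSq (mcomm (Q α) (Q β)) ≤
      (4 / 3) * (∑ α : Fin (n ^ 2), x α) ^ 2 := by
  refine quadratic_form_le_of_sum_sub_le (fun α β ↦ frobSq (mcomm (Q α) (Q β))) (by norm_num)
    (fun α β ↦ ?_) (fun α ↦ ?_) (sum_frobSq_mcomm_sub_le Q hHerm hON) x hx
  · rw [mcomm_swap, frobSq_neg]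
  · simp [mcomm, frobSq]
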